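/- For every real c > 0 there exists r₀ such that for every integer r ≥ r₀ there is a finite set S of points in ℝ² such that no line contains r+1 points of S, yet every subset T ⊆ S with |T| ≥ c·|S| contains r points on a common line. -/

import Mathlib

/-- A line in the plane: a one-dimensional affine subspace of ℝ², viewed as a set of points. -/
def IsLine (L : Set (Fin 2 → ℝ)) : Prop :=
  ∃ u v : Fin 2 → ℝ, v ≠ 0 ∧ L = {p | ∃ t : ℝ, p = u + t • v}


section Containers
set_option linter.unusedVariables false
set_option linter.unusedSectionVars false
variable {V : Type*} [Fintype V] [DecidableEq V]

/-- A family of sets is covered by at most `(|V|+1)^k` containers, each satisfying `P`. -/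
def ContGood (P : Finset V → Prop) (k : ℕ) (F : Set (Finset V)) : Prop :=
  ∃ 𝒞 : Finset (Finset V), 𝒞.card ≤ (Fintype.card V + 1) ^ k ∧ (∀ C ∈ 𝒞, P C) ∧
    ∀ I ∈ F, ∃ C ∈ 𝒞, I ⊆ C

lemma ContGood.mono {P : Finset V → Prop} {k k' : ℕ} {F F' : Set (Finset V)}
    (h : ContGood P k F) (hk : k ≤ k') (hF : F' ⊆ F) : ContGood P k' F' := by
  obtain ⟨C, h1, h2, h3⟩ := h
  exact ⟨C, h1.trans (Nat.pow_le_pow_right (by omega) hk), h2, fun I hI => h3 I (hF hI)⟩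

lemma ContGood.single {P : Finset V → Prop} (W : Finset V) (hW : P W) (k : ℕ)
    (F : Set (Finset V)) (hF : ∀ I ∈ F, I ⊆ W) : ContGood P k F := by
  refine ⟨{W}, ?_, by simpa using hW, fun I hI => ⟨W, by simp, hF I hI⟩⟩
  simpa using Nat.one_le_pow _ _ (by omega)

lemma ContGood.step {P : Finset V → Prop} {k : ℕ} {F : Set (Finset V)} (A : Finset V)
    (h0 : ContGood P k {I ∈ F | Disjoint I A})
    (h1 : ∀ v ∈ A, ContGood P k {I ∈ F | v ∈ I}) : ContGood P (k + 1) F := by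
  obtain ⟨C0, a0, b0, c0⟩ := h0
  choose! C1 a1 b1 c1 using h1
  refine ⟨C0 ∪ A.biUnion C1, ?_, ?_, ?_⟩
  · calc (C0 ∪ A.biUnion C1).card ≤ C0.card + (A.biUnion C1).card := Finset.card_union_le _ _
      _ ≤ (Fintype.card V + 1) ^ k + A.card * (Fintype.card V + 1) ^ k :=
          Nat.add_le_add a0 (Finset.card_biUnion_le_card_mul _ _ _ a1)
      _ ≤ (Fintype.card V + 1) ^ k + Fintype.card V * (Fintype.card V + 1) ^ k := by
          gcongr; exact Finset.card_le_univ A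
      _ = _ := by ring
  · intro C hC
    rw [Finset.mem_union, Finset.mem_biUnion] at hC
    rcases hC with hC | ⟨v, hv, hC⟩
    · exact b0 C hC
    · exact b1 v hv C hC
  · intro I hI
    by_cases hd : Disjoint I A
    · obtain ⟨C, hC, h⟩ := c0 I ⟨hI, hd⟩
      exact ⟨C, Finset.mem_union_left _ hC, h⟩
    · rw [Finset.not_disjoint_iff] at hd
      obtain ⟨v, hv, hvA⟩ := hd
      obtain ⟨C, hC, h⟩ := c1 v hvA I ⟨hI, hv⟩
      exact ⟨C, Finset.mem_union_right _ (Finset.mem_biUnion.2 ⟨v, hvA, hC⟩), h⟩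

/-- double counting of degrees -/
lemma sum_deg_eq (G : Finset (Finset V)) (i : ℕ) (hG : ∀ g ∈ G, g.card = i) :
    ∑ u : V, (G.filter (fun g => u ∈ g)).card = i * G.card := by
  have := Finset.sum_card_bipartiteAbove_eq_sum_card_bipartiteBelow
    (s := (Finset.univ : Finset V)) (t := G) (fun u g => u ∈ g)
  simp only [Finset.bipartiteAbove, Finset.bipartiteBelow] at this
  rw [this, Finset.sum_congr rfl (fun g hg => ?_), Finset.sum_const, smul_eq_mul, mul_comm]
  simpa using hG g hg

/-- The sets of `G` through `v` avoiding the saturated set whose residue is new. -/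
def newSets (G G' : Finset (Finset V)) (Γ : Finset V) (v : V) : Finset (Finset V) :=
  G.filter (fun g => v ∈ g ∧ Disjoint g Γ ∧ g.erase v ∉ G')

set_option maxHeartbeats 1000000 in
lemma counting_A (D G G' : Finset (Finset V)) (C lam i b b' : ℕ) (hi : 1 ≤ i) (hlam : 1 ≤ lam)
    (hb' : b' = 4 * b * (1 + C) * (i + 1)) (hb : 1 ≤ b)
    (hcod : ∀ u w : V, u ≠ w → (D.filter (fun g => u ∈ g ∧ w ∈ g)).card ≤ C)
    (hGD : G ⊆ D) (hGi : ∀ g ∈ G, g.card = i + 1)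
    (hGdeg : ∀ u, (G.filter (fun g => u ∈ g)).card ≤ (1 + C) * lam ^ i)
    (hGbig : Fintype.card V * lam ^ i ≤ b * G.card)
    (hGi' : ∀ g ∈ G', g.card = i)
    (hG'small : b' * G'.card < Fintype.card V * lam ^ (i - 1))
    (Γ : Finset V)
    (hΓ : Γ = Finset.univ.filter (fun u => lam ^ (i - 1) ≤ (G'.filter (fun g => u ∈ g)).card)) :
    Fintype.card V ≤ 4 * b * (1 + C) *
      (Finset.univ.filter (fun v => lam ^ i ≤ 4 * b * (newSets G G' Γ v).card)).card := by
  set N := Fintype.card V with hN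
  -- saturated set is small
  have h1 : b' * Γ.card ≤ i * N := by
    have e1 : Γ.card * lam ^ (i - 1) ≤ i * G'.card := by
      rw [← sum_deg_eq G' i hGi']
      calc Γ.card * lam ^ (i - 1) = ∑ u ∈ Γ, lam ^ (i - 1) := by simp
        _ ≤ ∑ u ∈ Γ, (G'.filter (fun g => u ∈ g)).card := by
            apply Finset.sum_le_sum; intro u hu; rw [hΓ] at hu; simpa using hu
        _ ≤ _ := Finset.sum_le_sum_of_subset (Finset.subset_univ _)
    have hp : 0 < lam ^ (i - 1) := by positivity
    refine Nat.le_of_mul_le_mul_right (c := lam ^ (i - 1)) ?_ hp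
    nlinarith
  -- bad edges
  have h2 : (G.filter (fun g => ¬ Disjoint g Γ)).card ≤ Γ.card * ((1 + C) * lam ^ i) := by
    have : G.filter (fun g => ¬ Disjoint g Γ) ⊆ Γ.biUnion (fun u => G.filter (fun g => u ∈ g)) := by
      intro g hg
      simp only [Finset.mem_filter, Finset.not_disjoint_iff, Finset.mem_biUnion] at hg ⊢
      obtain ⟨a, u, b, c⟩ := hg
      exact ⟨u, c, a, b⟩
    exact (Finset.card_le_card this).trans (Finset.card_biUnion_le_card_mul _ _ _ (fun u _ => hGdeg u))
  -- pairs
  let good := G.filter (fun g => Disjoint g Γ)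
  let pairs : Finset (Σ _ : V, Finset V) :=
    (Finset.univ : Finset V).sigma (fun v => good.filter (fun g => v ∈ g))
  have hpairs : pairs.card = (i + 1) * good.card := by
    rw [Finset.card_sigma]
    exact sum_deg_eq good (i + 1) (fun g hg => hGi g (Finset.mem_filter.1 hg).1)
  have hnew : (pairs.filter (fun x => x.2.erase x.1 ∉ G')).card
      = ∑ v : V, (newSets G G' Γ v).card := by
    rw [← Finset.card_sigma]
    congr 1
    ext ⟨v, g⟩
    simp [pairs, good, newSets]
    tauto
  have hold : (pairs.filter (fun x => ¬ (x.2.erase x.1 ∉ G'))).card ≤ C * G'.card := by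
    apply Finset.card_le_mul_card_image_of_maps_to (f := fun x => x.2.erase x.1)
    · intro x hx
      simpa using (Finset.mem_filter.1 hx).2
    · intro g' hg'
      have hc := hGi' g' hg'
      rcases Nat.lt_or_ge 1 i with h | h
      · obtain ⟨u, hu, w, hw, huw⟩ := Finset.one_lt_card.1 (by omega : 1 < g'.card)
        refine le_trans ?_ (hcod u w huw)
        apply Finset.card_le_card_of_injOn (fun x => x.2)
        · rintro ⟨v, g⟩ hx
          simp [pairs, good] at hx
          obtain ⟨⟨⟨⟨h1, h2⟩, h3⟩, h4⟩, h5⟩ := hx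
          subst h5
          simp
          exact ⟨hGD h1, (Finset.mem_erase.1 hu).2, (Finset.mem_erase.1 hw).2⟩
        · rintro ⟨v, g⟩ hx ⟨v', g2⟩ hx' (he : g = g2)
          subst he
          simp [pairs, good] at hx hx'
          have : v = v' := by
            by_contra hne
            have : v ∈ g.erase v' := Finset.mem_erase.2 ⟨hne, hx.1.1.2⟩
            rw [hx'.2, ← hx.2] at this
            simp at this
          subst this; rfl
      · have hi1 : i = 1 := by omega
        subst hi1
        rw [Finset.card_eq_zero.2]
        · exact Nat.zero_le _
        · rw [Finset.eq_empty_iff_forall_notMem]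
          rintro ⟨v, g⟩ hx
          simp [pairs, good] at hx
          obtain ⟨⟨⟨⟨h1, h2⟩, h3⟩, h4⟩, h5⟩ := hx
          subst h5
          obtain ⟨w, hw⟩ := Finset.card_pos.1 (by omega : 0 < (g.erase v).card)
          apply Finset.disjoint_left.1 h2 (Finset.mem_erase.1 hw).2
          rw [hΓ]
          simp
          exact ⟨g.erase v, Finset.mem_filter.2 ⟨h4, hw⟩⟩
  have hsplit := Finset.card_filter_add_card_filter_not (s := pairs) (fun x => x.2.erase x.1 ∉ G')
  have hsplit2 := Finset.card_filter_add_card_filter_not (s := G) (fun g => Disjoint g Γ)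
  set Sg := ∑ v : V, (newSets G G' Γ v).card with hSg
  have hmain : G.card ≤ Sg + Γ.card * ((1 + C) * lam ^ i) + C * G'.card := by
    have : good.card ≤ pairs.card := by rw [hpairs]; nlinarith
    have : good.card + (G.filter (fun g => ¬ Disjoint g Γ)).card = G.card := hsplit2
    omega
  have hpl : lam ^ (i - 1) ≤ lam ^ i := Nat.pow_le_pow_right hlam (by omega)
  have hb'pos : 0 < b' := by rw [hb']; positivity
  have hS : 3 * (N * lam ^ i) ≤ 4 * b * Sg := by
    refine Nat.le_of_mul_le_mul_left (c := b') ?_ hb'pos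
    have t1 : 4 * b' * (N * lam ^ i) ≤ 4 * b' * (b * G.card) := Nat.mul_le_mul_left _ hGbig
    have t2 : 4 * b' * b * G.card ≤ 4 * b' * b * (Sg + Γ.card * ((1 + C) * lam ^ i) + C * G'.card) :=
      Nat.mul_le_mul_left _ hmain
    have t3 : b' * Γ.card * (4 * b * ((1 + C) * lam ^ i)) ≤ i * N * (4 * b * ((1 + C) * lam ^ i)) :=
      Nat.mul_le_mul_right _ h1
    have t4 : b' * G'.card * (4 * b * C) ≤ N * lam ^ i * (4 * b * C) :=
      Nat.mul_le_mul_right _ (hG'small.le.trans (Nat.mul_le_mul_left _ hpl))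
    have t5 : (4 * b * (1 + C) * i + 4 * b * C) * (N * lam ^ i) ≤ b' * (N * lam ^ i) := by
      apply Nat.mul_le_mul_right
      rw [hb']; nlinarith
    nlinarith
  set A := (Finset.univ.filter (fun v => lam ^ i ≤ 4 * b * (newSets G G' Γ v).card)) with hA
  have hsum : 4 * b * Sg ≤ A.card * (4 * b * ((1 + C) * lam ^ i)) + N * lam ^ i := by
    rw [hSg, Finset.mul_sum, ← Finset.sum_filter_add_sum_filter_not Finset.univ
      (fun v => lam ^ i ≤ 4 * b * (newSets G G' Γ v).card)]
    apply Nat.add_le_add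
    · apply Finset.sum_le_card_nsmul
      intro v _
      apply Nat.mul_le_mul_left
      refine le_trans (Finset.card_le_card ?_) (hGdeg v)
      intro g hg
      simp only [newSets, Finset.mem_filter] at hg ⊢
      exact ⟨hg.1, hg.2.1⟩
    · refine le_trans (Finset.sum_le_card_nsmul _ _ (lam ^ i) ?_) ?_
      · intro v hv
        have := (Finset.mem_filter.1 hv).2
        omega
      · rw [smul_eq_mul]
        exact Nat.mul_le_mul_right _ (Finset.card_le_univ _)
  have hp : 0 < lam ^ i := by positivity
  refine Nat.le_of_mul_le_mul_right (c := lam ^ i) ?_ hp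
  nlinarith

lemma level_lemma (i C : ℕ) (hi : 1 ≤ i) : ∀ b : ℕ, 1 ≤ b → ∃ a : ℕ, 1 ≤ a ∧
    ∀ {V : Type} [Fintype V] [DecidableEq V] (P : Finset V → Prop) (lam q : ℕ) (hlam : 1 ≤ lam)
      (hq : lam * q = Fintype.card V) (D : Finset (Finset V))
      (hDdown : ∀ g ∈ D, ∀ g' ⊆ g, g' ∈ D)
      (hcod : ∀ u w : V, u ≠ w → (D.filter (fun g => u ∈ g ∧ w ∈ g)).card ≤ C)
      (W : Finset V) (G : Finset (Finset V)) (k : ℕ) (F : Set (Finset V))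
      (hGD : G ⊆ D) (hGi : ∀ g ∈ G, g.card = i) (hGW : ∀ g ∈ G, g ⊆ W)
      (hGdeg : ∀ u, (G.filter (fun g => u ∈ g)).card ≤ (1 + C) * lam ^ (i - 1))
      (hGbig : Fintype.card V * lam ^ (i - 1) ≤ b * G.card)
      (hFW : ∀ I ∈ F, I ⊆ W) (hFG : ∀ I ∈ F, ∀ g ∈ G, ¬ g ⊆ I)
      (hshrink : ∀ A ⊆ W, Fintype.card V ≤ a * A.card →
        ContGood P k {I ∈ F | I ⊆ W \ A}),
      ContGood P (k + (i - 1) * q) F := by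
  induction i, hi using Nat.le_induction with
  | base =>
    intro b hb
    refine ⟨b, hb, ?_⟩
    intro V _ _ P lam q hlam hq D hDdown hcod W G k F hGD hGi hGW hGdeg hGbig hFW hFG hshrink
    have hc : (G.biUnion id).card = G.card := by
      rw [Finset.card_biUnion]
      · rw [Finset.sum_congr rfl (fun g hg => (hGi g hg : (id g).card = 1))]; simp
      · intro g hg g' hg' hne
        obtain ⟨x, rfl⟩ := Finset.card_eq_one.1 (hGi g hg)
        obtain ⟨y, rfl⟩ := Finset.card_eq_one.1 (hGi g' hg')
        have hxy : x ≠ y := by simpa using hne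
        simpa [Function.onFun] using hxy
    refine (hshrink (G.biUnion id) ?_ ?_).mono (by omega) ?_
    · rw [Finset.biUnion_subset]; exact hGW
    · rw [hc]; simpa using hGbig
    · intro I hI
      refine ⟨hI, ?_⟩
      intro x hx
      rw [Finset.mem_sdiff]
      refine ⟨hFW I hI hx, ?_⟩
      intro hxG
      obtain ⟨g, hg, hxg⟩ := Finset.mem_biUnion.1 hxG
      obtain ⟨y, rfl⟩ := Finset.card_eq_one.1 (hGi g hg)
      apply hFG I hI _ hg
      simp at hxg
      subst hxg
      simpa using hx
  | succ i hi ih =>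
    intro b hb
    obtain ⟨a', ha', hlev⟩ := ih (4 * b * (1 + C) * (i + 1)) (Nat.one_le_iff_ne_zero.2 (by positivity))
    refine ⟨a' + 4 * b * (1 + C), by omega, ?_⟩
    intro V _ _ P lam q hlam hq D hDdown hcod W G k F hGD hGi hGW hGdeg hGbig hFW hFG hshrink
    simp only [Nat.add_sub_cancel] at hGdeg hGbig ⊢
    set b' := 4 * b * (1 + C) * (i + 1) with hb'
    have key : ∀ t : ℕ, ∀ (G' : Finset (Finset V)) (F' : Set (Finset V)), F' ⊆ F → G' ⊆ D →
        (∀ g ∈ G', g.card = i) → (∀ g ∈ G', g ⊆ W) →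
        (∀ u, (G'.filter (fun g => u ∈ g)).card ≤ (1 + C) * lam ^ (i - 1)) →
        (∀ I ∈ F', ∀ g ∈ G', ¬ g ⊆ I) →
        4 * b * (Fintype.card V * lam ^ (i - 1)) ≤ 4 * b * (b' * G'.card) + t * (b' * lam ^ i) →
        ContGood P (k + (i - 1) * q + t) F' := by
      intro t
      induction t with
      | zero =>
        intro G' F' hF' hG'D hG'i hG'W hG'deg hF'G' hbig
        refine (hlev P lam q hlam hq D hDdown hcod W G' k F' hG'D hG'i hG'W hG'deg ?_
          (fun I hI => hFW I (hF' hI)) hF'G' ?_)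
        · simp only [zero_mul, add_zero] at hbig
          exact Nat.le_of_mul_le_mul_left hbig (by positivity)
        · intro A hA hA2
          exact (hshrink A hA (hA2.trans (by gcongr; omega))).mono le_rfl
            (fun I hI => ⟨hF' hI.1, hI.2⟩)
      | succ t iht =>
        intro G' F' hF' hG'D hG'i hG'W hG'deg hF'G' hbig
        rcases Nat.lt_or_ge (b' * G'.card) (Fintype.card V * lam ^ (i - 1)) with hsm | hlg
        · set Γ := Finset.univ.filter
            (fun u => lam ^ (i - 1) ≤ (G'.filter (fun g => u ∈ g)).card) with hΓ
          have hA := counting_A D G G' C lam i b b' hi hlam hb' hb hcod hGD hGi hGdeg hGbig hG'i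
            hsm Γ hΓ
          set A := Finset.univ.filter (fun v => lam ^ i ≤ 4 * b * (newSets G G' Γ v).card) with hAdef
          have hAW : A ⊆ W := by
            intro v hv
            have h1 := (Finset.mem_filter.1 hv).2
            have h2 : 0 < (newSets G G' Γ v).card := by
              rcases Nat.eq_zero_or_pos (newSets G G' Γ v).card with h | h
              · rw [h] at h1
                have : 0 < lam ^ i := by positivity
                omega
              · exact h
            obtain ⟨g, hg⟩ := Finset.card_pos.1 h2
            have hg := Finset.mem_filter.1 hg
            exact hGW g hg.1 hg.2.1
          rw [← add_assoc]
          apply ContGood.step A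
          · refine (hshrink A hAW (hA.trans (by gcongr; omega))).mono (by omega) ?_
            rintro I ⟨hI, hd⟩
            refine ⟨hF' hI, ?_⟩
            intro x hx
            rw [Finset.mem_sdiff]
            exact ⟨hFW I (hF' hI) hx, Finset.disjoint_left.1 hd hx⟩
          · intro v hv
            have hvA := (Finset.mem_filter.1 hv).2
            set Nw := (newSets G G' Γ v).image (fun g => g.erase v) with hNw
            have hNwcard : Nw.card = (newSets G G' Γ v).card := by
              apply Finset.card_image_of_injOn
              intro g hg g2 hg2 he
              have hg := (Finset.mem_filter.1 hg).2.1
              have hg2 := (Finset.mem_filter.1 hg2).2.1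
              simp only at he
              rw [← Finset.insert_erase hg, he, Finset.insert_erase hg2]
            have hmem : ∀ g' ∈ Nw, ∃ g ∈ G, v ∈ g ∧ Disjoint g Γ ∧ g.erase v ∉ G' ∧
                g' = g.erase v := by
              intro g' hg'
              obtain ⟨g, hg, rfl⟩ := Finset.mem_image.1 hg'
              obtain ⟨h1, h2, h3, h4⟩ := Finset.mem_filter.1 hg
              exact ⟨g, h1, h2, h3, h4, rfl⟩
            have hdisj : Disjoint G' Nw := by
              rw [Finset.disjoint_right]
              intro g' hg'
              obtain ⟨g, h1, h2, h3, h4, rfl⟩ := hmem g' hg'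
              exact h4
            apply iht (G' ∪ Nw) _ (fun I hI => hF' hI.1)
            · apply Finset.union_subset hG'D
              intro g' hg'
              obtain ⟨g, h1, h2, h3, h4, rfl⟩ := hmem g' hg'
              exact hDdown g (hGD h1) _ (Finset.erase_subset _ _)
            · intro g' hg'
              rcases Finset.mem_union.1 hg' with hg' | hg'
              · exact hG'i g' hg'
              · obtain ⟨g, h1, h2, h3, h4, rfl⟩ := hmem g' hg'
                rw [Finset.card_erase_of_mem h2, hGi g h1]; rfl
            · intro g' hg'
              rcases Finset.mem_union.1 hg' with hg' | hg'
              · exact hG'W g' hg'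
              · obtain ⟨g, h1, h2, h3, h4, rfl⟩ := hmem g' hg'
                exact (Finset.erase_subset _ _).trans (hGW g h1)
            · intro u
              rw [Finset.filter_union]
              by_cases hu : u ∈ Γ
              · have : Nw.filter (fun g => u ∈ g) = ∅ := by
                  rw [Finset.filter_eq_empty_iff]
                  intro g' hg' hug
                  obtain ⟨g, h1, h2, h3, h4, rfl⟩ := hmem g' hg'
                  exact Finset.disjoint_left.1 h3 (Finset.mem_erase.1 hug).2 hu
                rw [this, Finset.union_empty]
                exact hG'deg u
              · have h5 : (G'.filter (fun g => u ∈ g)).card ≤ lam ^ (i - 1) := by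
                  by_contra hcon
                  apply hu
                  rw [hΓ, Finset.mem_filter]
                  exact ⟨Finset.mem_univ _, by omega⟩
                have h6 : (Nw.filter (fun g => u ∈ g)).card ≤ C := by
                  by_cases huv : u = v
                  · subst huv
                    rw [Finset.card_eq_zero.2]
                    · exact Nat.zero_le _
                    rw [Finset.filter_eq_empty_iff]
                    intro g' hg' hug
                    obtain ⟨g, h1, h2, h3, h4, rfl⟩ := hmem g' hg'
                    simp at hug
                  · refine le_trans (le_trans (Finset.card_le_card ?_)
                      (Finset.card_image_le (f := fun g => Finset.erase g v))) (hcod u v huv)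
                    intro g' hg'
                    obtain ⟨hg', hug⟩ := Finset.mem_filter.1 hg'
                    obtain ⟨g, h1, h2, h3, h4, rfl⟩ := hmem g' hg'
                    exact Finset.mem_image.2 ⟨g, Finset.mem_filter.2
                      ⟨hGD h1, (Finset.mem_erase.1 hug).2, h2⟩, rfl⟩
                have h7 : 1 ≤ lam ^ (i - 1) := Nat.one_le_pow _ _ hlam
                refine (Finset.card_union_le _ _).trans ?_
                nlinarith
            · rintro I ⟨hI, hvI⟩ g' hg' hsub
              rcases Finset.mem_union.1 hg' with hg' | hg'
              · exact hF'G' I hI g' hg' hsub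
              · obtain ⟨g, h1, h2, h3, h4, rfl⟩ := hmem g' hg'
                apply hFG I (hF' hI) g h1
                rw [← Finset.insert_erase h2]
                exact Finset.insert_subset hvI hsub
            · rw [Finset.card_union_of_disjoint hdisj, hNwcard]
              have := Nat.mul_le_mul_left b' hvA
              nlinarith
        · refine (hlev P lam q hlam hq D hDdown hcod W G' k F' hG'D hG'i hG'W hG'deg hlg
            (fun I hI => hFW I (hF' hI)) hF'G' ?_).mono (by omega) (fun _ h => h)
          intro A hA hA2
          exact (hshrink A hA (hA2.trans (by gcongr; omega))).mono le_rfl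
            (fun I hI => ⟨hF' hI.1, hI.2⟩)
    have h := key q ∅ F (fun _ h => h) (by simp) (by simp) (by simp) (by simp) (by simp) ?_
    · refine h.mono ?_ (fun _ h => h)
      obtain ⟨j, rfl⟩ : ∃ j, i = j + 1 := ⟨i - 1, by omega⟩
      simp only [Nat.add_sub_cancel]
      nlinarith
    · obtain ⟨j, rfl⟩ : ∃ j, i = j + 1 := ⟨i - 1, by omega⟩
      simp only [Nat.add_sub_cancel, Finset.card_empty, mul_zero, zero_add]
      have : q * (b' * lam ^ (j + 1)) = b' * (Fintype.card V * lam ^ j) := by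
        rw [← hq]; ring
      rw [this]
      apply Nat.mul_le_mul_right
      rw [hb']; nlinarith [Nat.zero_le (b * C), Nat.zero_le (b * j), Nat.zero_le (b * C * j)]

/-- Container theorem for uniform hypergraphs with bounded pair-codegrees. -/
theorem container_theorem (r C E b : ℕ) (hr : 2 ≤ r) (hb : 1 ≤ b) : ∃ L : ℕ,
    ∀ {V : Type} [Fintype V] [DecidableEq V] (lam : ℕ) (hlam : 1 ≤ lam)
      (hN : Fintype.card V = lam ^ (r - 1)) (H : Finset (Finset V))
      (hHr : ∀ e ∈ H, e.card = r)
      (hcod : ∀ u w : V, u ≠ w → (H.filter (fun g => u ∈ g ∧ w ∈ g)).card ≤ C)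
      (hsat : ∀ W : Finset V, Fintype.card V < E * W.card →
        Fintype.card V * Fintype.card V ≤ b * (H.filter (fun e => e ⊆ W)).card),
      ∃ 𝒞 : Finset (Finset V), 𝒞.card ≤ (Fintype.card V + 1) ^ (L * lam ^ (r - 2)) ∧
        (∀ S ∈ 𝒞, E * S.card ≤ Fintype.card V) ∧
        ∀ I : Finset V, (∀ e ∈ H, ¬ e ⊆ I) → ∃ S ∈ 𝒞, I ⊆ S := by
  obtain ⟨a, ha, hlev⟩ := level_lemma r (C * 2 ^ r) (by omega) b hb
  refine ⟨a * (r - 1), ?_⟩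
  intro V _ _ lam hlam hN H hHr hcod hsat
  set q := lam ^ (r - 2) with hqdef
  have hq : lam * q = Fintype.card V := by
    rw [hN, hqdef, ← pow_succ']; congr 1; omega
  let D := H.biUnion Finset.powerset
  have hHD : H ⊆ D := fun e he => Finset.mem_biUnion.2 ⟨e, he, by simp⟩
  have hDdown : ∀ g ∈ D, ∀ g' ⊆ g, g' ∈ D := by
    intro g hg g' hg'
    obtain ⟨e, he, hge⟩ := Finset.mem_biUnion.1 hg
    exact Finset.mem_biUnion.2 ⟨e, he, Finset.mem_powerset.2 (hg'.trans (Finset.mem_powerset.1 hge))⟩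
  have hDcod : ∀ u w : V, u ≠ w → (D.filter (fun g => u ∈ g ∧ w ∈ g)).card ≤ C * 2 ^ r := by
    intro u w huw
    have : D.filter (fun g => u ∈ g ∧ w ∈ g) ⊆
        (H.filter (fun g => u ∈ g ∧ w ∈ g)).biUnion Finset.powerset := by
      intro g hg
      obtain ⟨h1, h2, h3⟩ := Finset.mem_filter.1 hg
      obtain ⟨e, he, hge⟩ := Finset.mem_biUnion.1 h1
      have hge' := Finset.mem_powerset.1 hge
      exact Finset.mem_biUnion.2 ⟨e, Finset.mem_filter.2 ⟨he, hge' h2, hge' h3⟩, hge⟩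
    refine (Finset.card_le_card this).trans ((Finset.card_biUnion_le_card_mul _ _ (2 ^ r) ?_).trans
      (Nat.mul_le_mul_right _ (hcod u w huw)))
    intro e he
    rw [Finset.card_powerset, hHr e (Finset.mem_filter.1 he).1]
  have hdeg : ∀ u, (H.filter (fun g => u ∈ g)).card ≤ (1 + C * 2 ^ r) * lam ^ (r - 1) := by
    intro u
    have : H.filter (fun g => u ∈ g) ⊆ (Finset.univ.erase u).biUnion
        (fun w => D.filter (fun g => u ∈ g ∧ w ∈ g)) := by
      intro g hg
      obtain ⟨h1, h2⟩ := Finset.mem_filter.1 hg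
      obtain ⟨w, hw, hwu⟩ := Finset.exists_mem_ne (by rw [hHr g h1]; omega : 1 < g.card) u
      exact Finset.mem_biUnion.2 ⟨w, by simp [hwu], Finset.mem_filter.2 ⟨hHD h1, h2, hw⟩⟩
    refine (Finset.card_le_card this).trans ((Finset.card_biUnion_le_card_mul _ _ (C * 2 ^ r)
      (fun w hw => hDcod u w (Finset.ne_of_mem_erase hw).symm)).trans ?_)
    have h1 : (Finset.univ.erase u).card ≤ lam ^ (r - 1) := by
      rw [← hN]; exact Finset.card_le_univ _
    nlinarith [Nat.zero_le (C * 2 ^ r)]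
  have key : ∀ j : ℕ, ∀ W : Finset V, a * W.card ≤ Fintype.card V * j →
      ContGood (fun S : Finset V => E * S.card ≤ Fintype.card V) (j * ((r - 1) * q))
        {I | I ⊆ W ∧ ∀ e ∈ H, ¬ e ⊆ I} := by
    intro j
    induction j with
    | zero =>
      intro W hW
      refine ContGood.single W ?_ _ _ (fun I hI => hI.1)
      have : W.card = 0 := by
        rcases Nat.eq_zero_or_pos W.card with h | h
        · exact h
        · have := Nat.mul_pos (show 0 < a by omega) h; omega
      simp [this]
    | succ j ih =>
      intro W hW
      rcases Nat.lt_or_ge (Fintype.card V) (E * W.card) with hlt | hge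
      · rw [Nat.succ_mul]
        apply hlev _ lam q hlam hq D hDdown hDcod W (H.filter (fun e => e ⊆ W)) _ _
          ((Finset.filter_subset _ _).trans hHD)
          (fun g hg => hHr g (Finset.mem_filter.1 hg).1) (fun g hg => (Finset.mem_filter.1 hg).2)
        · intro u
          refine le_trans (Finset.card_le_card ?_) (hdeg u)
          exact Finset.filter_subset_filter _ (Finset.filter_subset _ _)
        · rw [← hN]; exact hsat W hlt
        · exact fun I hI => hI.1
        · exact fun I hI g hg => hI.2 g (Finset.mem_filter.1 hg).1
        · intro A hA hA2
          refine (ih (W \ A) ?_).mono le_rfl (fun I hI => ⟨hI.2, hI.1.2⟩)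
          rw [Finset.card_sdiff_of_subset hA]
          have := Finset.card_le_card hA
          rw [Nat.mul_sub]
          rw [Nat.mul_succ] at hW
          omega
      · exact ContGood.single W hge _ _ (fun I hI => hI.1)
  obtain ⟨𝒞, h1, h2, h3⟩ := key a Finset.univ (by rw [Finset.card_univ, mul_comm])
  refine ⟨𝒞, by rwa [mul_assoc], h2, fun I hI => h3 I ⟨Finset.subset_univ _, hI⟩⟩
end Containers


section RandomSubset
variable {V : Type} [Fintype V] [DecidableEq V]

lemma count_extend {a m : ℕ} (ι : Fin a → Fin m) (hι : Function.Injective ι) (b : Fin a → V) :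
    (Finset.univ.filter (fun f : Fin m → V => f ∘ ι = b)).card * Fintype.card V ^ a
      ≤ Fintype.card V ^ m := by
  have h1 : Finset.univ.filter (fun f : Fin m → V => f ∘ ι = b) ⊆
      Fintype.piFinset (fun j => if j ∈ Finset.univ.image ι then
        Finset.univ.filter (fun v => ∀ t, ι t = j → b t = v) else Finset.univ) := by
    intro f hf
    have hf := (Finset.mem_filter.1 hf).2
    rw [Fintype.mem_piFinset]
    intro j
    split_ifs
    · rw [Finset.mem_filter]
      refine ⟨Finset.mem_univ _, fun t ht => ?_⟩
      rw [← hf, ← ht]; rfl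
    · exact Finset.mem_univ _
  have hcard : (Finset.univ.image ι).card = a := by
    rw [Finset.card_image_of_injective _ hι]; simp
  have h2 : (Finset.univ.filter (fun f : Fin m → V => f ∘ ι = b)).card ≤
      Fintype.card V ^ (m - a) := by
    refine (Finset.card_le_card h1).trans ?_
    rw [Fintype.card_piFinset]
    calc _ ≤ ∏ j : Fin m, (if j ∈ Finset.univ.image ι then 1 else Fintype.card V) := by
          apply Finset.prod_le_prod'
          intro j _
          split_ifs with hj
          · obtain ⟨t, _, ht⟩ := Finset.mem_image.1 hj
            rw [Finset.card_le_one]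
            intro v hv w hw
            rw [← (Finset.mem_filter.1 hv).2 t ht, ← (Finset.mem_filter.1 hw).2 t ht]
          · exact le_of_eq Finset.card_univ
      _ = _ := by
          rw [Finset.prod_ite]
          simp only [Finset.prod_const, one_pow, one_mul]
          congr 1
          rw [Finset.filter_not, Finset.card_sdiff_of_subset (Finset.subset_univ _)]
          simp only [Finset.filter_univ_mem]
          rw [hcard]; simp
  have ham : a ≤ m := by simpa using Fintype.card_le_of_injective ι hι
  calc _ ≤ Fintype.card V ^ (m - a) * Fintype.card V ^ a := Nat.mul_le_mul_right _ h2
    _ = _ := by rw [← pow_add]; congr 1; omega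

/-- number of injective index tuples landing in `B` -/
def tupCount {a m : ℕ} (B : Finset (Fin a → V)) (f : Fin m → V) : ℕ :=
  (Finset.univ.filter (fun ι : Fin a → Fin m => Function.Injective ι ∧ f ∘ ι ∈ B)).card

lemma sum_tupCount {a m : ℕ} (B : Finset (Fin a → V)) :
    (∑ f : Fin m → V, tupCount B f) * Fintype.card V ^ a ≤ m ^ a * (B.card * Fintype.card V ^ m) := by
  have h := Finset.sum_card_bipartiteAbove_eq_sum_card_bipartiteBelow
    (s := (Finset.univ : Finset (Fin m → V))) (t := (Finset.univ : Finset (Fin a → Fin m)))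
    (fun f ι => Function.Injective ι ∧ f ∘ ι ∈ B)
  simp only [Finset.bipartiteAbove, Finset.bipartiteBelow] at h
  unfold tupCount
  rw [h, Finset.sum_mul]
  refine (Finset.sum_le_card_nsmul _ _ (B.card * Fintype.card V ^ m) ?_).trans (le_of_eq ?_)
  · intro ι _
    by_cases hι : Function.Injective ι
    · have : (Finset.univ.filter (fun f : Fin m → V => Function.Injective ι ∧ f ∘ ι ∈ B)) ⊆
          B.biUnion (fun b => Finset.univ.filter (fun f : Fin m → V => f ∘ ι = b)) := by
        intro f hf
        simp at hf ⊢
        exact hf.2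
      calc _ ≤ (∑ b ∈ B, (Finset.univ.filter (fun f : Fin m → V => f ∘ ι = b)).card)
                * Fintype.card V ^ a :=
            Nat.mul_le_mul_right _ ((Finset.card_le_card this).trans Finset.card_biUnion_le)
        _ = ∑ b ∈ B, (Finset.univ.filter (fun f : Fin m → V => f ∘ ι = b)).card
                * Fintype.card V ^ a := Finset.sum_mul _ _ _
        _ ≤ ∑ b ∈ B, Fintype.card V ^ m := Finset.sum_le_sum (fun b _ => count_extend ι hι b)
        _ = _ := by simp
    · simp [hι]
  · simp

lemma count_container {m E : ℕ} (J : Finset (Fin m)) (C : Finset V)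
    (hC : E * C.card ≤ Fintype.card V) :
    (Finset.univ.filter (fun f : Fin m → V => ∀ j ∈ J, f j ∈ C)).card * E ^ J.card
      ≤ Fintype.card V ^ m := by
  have h1 : Finset.univ.filter (fun f : Fin m → V => ∀ j ∈ J, f j ∈ C) ⊆
      Fintype.piFinset (fun j => if j ∈ J then C else Finset.univ) := by
    intro f hf
    have hf := (Finset.mem_filter.1 hf).2
    rw [Fintype.mem_piFinset]
    intro j
    split_ifs with h
    · exact hf j h
    · exact Finset.mem_univ _
  have hle : J.card ≤ m := by simpa using Finset.card_le_univ J
  have h2 : (Finset.univ.filter (fun f : Fin m → V => ∀ j ∈ J, f j ∈ C)).card ≤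
      C.card ^ J.card * Fintype.card V ^ (m - J.card) := by
    refine (Finset.card_le_card h1).trans ?_
    rw [Fintype.card_piFinset]
    have : ∀ j : Fin m, (if j ∈ J then C else (Finset.univ : Finset V)).card =
        if j ∈ J then C.card else Fintype.card V := by
      intro j; split_ifs <;> simp
    simp only [this]
    rw [Finset.prod_ite]
    simp only [Finset.prod_const]
    rw [Finset.filter_not, Finset.card_sdiff_of_subset (Finset.subset_univ _)]
    simp only [Finset.filter_univ_mem]
    simp
  calc _ ≤ C.card ^ J.card * Fintype.card V ^ (m - J.card) * E ^ J.card :=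
        Nat.mul_le_mul_right _ h2
    _ = (E * C.card) ^ J.card * Fintype.card V ^ (m - J.card) := by rw [mul_pow]; ring
    _ ≤ Fintype.card V ^ J.card * Fintype.card V ^ (m - J.card) := by gcongr
    _ = _ := by rw [← pow_add]; congr 1; omega

theorem random_subset (m r q0 E : ℕ) (𝒞 : Finset (Finset V)) (B : Finset (Fin (r + 1) → V))
    (h𝒞 : 𝒞.card ≤ 2 ^ m) (hE : ∀ C ∈ 𝒞, E * C.card ≤ Fintype.card V) (hE2 : 8 ^ q0 ≤ E)
    (hm : 1 ≤ m) (h1 : 16 * m ≤ Fintype.card V)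
    (h2 : 16 * (m ^ r * B.card) ≤ Fintype.card V ^ (r + 1)) :
    ∃ S : Finset V, m ≤ 2 * S.card ∧
      (∀ b ∈ B, Function.Injective b → ∃ t, b t ∉ S) ∧
      ∀ T ⊆ S, m ≤ q0 * T.card → ∀ C ∈ 𝒞, ¬ T ⊆ C := by
  set N := Fintype.card V with hN
  have hNpos : 0 < N := by omega
  let Dg : Finset (Fin 2 → V) := Finset.univ.image (fun v : V => fun _ => v)
  have hDg : Dg.card ≤ N := Finset.card_image_le
  -- expected number of bad tuples
  have hX1 : 16 * (∑ f : Fin m → V, tupCount Dg f) ≤ m * N ^ m := by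
    have := sum_tupCount (m := m) Dg
    rw [← hN] at this
    refine Nat.le_of_mul_le_mul_right (c := N ^ 2) ?_ (by positivity)
    calc 16 * (∑ f : Fin m → V, tupCount Dg f) * N ^ 2
        = 16 * ((∑ f : Fin m → V, tupCount Dg f) * N ^ 2) := by ring
      _ ≤ 16 * (m ^ 2 * (Dg.card * N ^ m)) := Nat.mul_le_mul_left _ this
      _ ≤ 16 * (m ^ 2 * (N * N ^ m)) := by gcongr
      _ = (16 * m) * (m * (N * N ^ m)) := by ring
      _ ≤ N * (m * (N * N ^ m)) := Nat.mul_le_mul_right _ h1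
      _ = _ := by ring
  have hX2 : 16 * (∑ f : Fin m → V, tupCount B f) ≤ m * N ^ m := by
    have := sum_tupCount (m := m) B
    rw [← hN] at this
    refine Nat.le_of_mul_le_mul_right (c := N ^ (r + 1)) ?_ (by positivity)
    calc 16 * (∑ f : Fin m → V, tupCount B f) * N ^ (r + 1)
        = 16 * ((∑ f : Fin m → V, tupCount B f) * N ^ (r + 1)) := by ring
      _ ≤ 16 * (m ^ (r + 1) * (B.card * N ^ m)) := Nat.mul_le_mul_left _ this
      _ = (16 * (m ^ r * B.card)) * (m * N ^ m) := by ring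
      _ ≤ N ^ (r + 1) * (m * N ^ m) := Nat.mul_le_mul_right _ h2
      _ = _ := by ring
  -- container-bad functions
  let Y : Finset (Fin m → V) := (Finset.univ.filter (fun J : Finset (Fin m) => m ≤ q0 * J.card)).biUnion
    (fun J => 𝒞.biUnion (fun C => Finset.univ.filter (fun f : Fin m → V => ∀ j ∈ J, f j ∈ C)))
  have hY : 2 * Y.card ≤ N ^ m := by
    have hone : ∀ J : Finset (Fin m), m ≤ q0 * J.card → ∀ C ∈ 𝒞,
        (Finset.univ.filter (fun f : Fin m → V => ∀ j ∈ J, f j ∈ C)).card ≤ N ^ m / 8 ^ m := by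
      intro J hJ C hC
      rw [Nat.le_div_iff_mul_le (by positivity)]
      refine le_trans (Nat.mul_le_mul_left _ ?_) (count_container J C (hE C hC))
      calc 8 ^ m ≤ 8 ^ (q0 * J.card) := Nat.pow_le_pow_right (by norm_num) hJ
        _ = (8 ^ q0) ^ J.card := by rw [pow_mul]
        _ ≤ E ^ J.card := Nat.pow_le_pow_left hE2 _
    have hYc : Y.card ≤ 2 ^ m * (2 ^ m * (N ^ m / 8 ^ m)) := by
      refine (Finset.card_biUnion_le_card_mul _ _ (2 ^ m * (N ^ m / 8 ^ m)) ?_).trans ?_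
      · intro J hJ
        refine (Finset.card_biUnion_le_card_mul _ _ (N ^ m / 8 ^ m) ?_).trans
          (Nat.mul_le_mul_right _ h𝒞)
        intro C hC
        exact hone J (Finset.mem_filter.1 hJ).2 C hC
      · apply Nat.mul_le_mul_right
        refine (Finset.card_filter_le _ _).trans ?_
        simp
    have h8 : (8 : ℕ) ^ m = 2 ^ m * 2 ^ m * 2 ^ m := by
      rw [← mul_pow, ← mul_pow]; norm_num
    have hdiv : N ^ m / 8 ^ m * 8 ^ m ≤ N ^ m := Nat.div_mul_le_self _ _
    have h2m : 2 ≤ 2 ^ m := by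
      calc 2 = 2 ^ 1 := rfl
        _ ≤ 2 ^ m := Nat.pow_le_pow_right (by norm_num) hm
    calc 2 * Y.card ≤ 2 ^ m * (2 ^ m * (2 ^ m * (N ^ m / 8 ^ m))) := Nat.mul_le_mul h2m hYc
      _ = N ^ m / 8 ^ m * 8 ^ m := by rw [h8]; ring
      _ ≤ N ^ m := hdiv
  -- choose f
  obtain ⟨f, hfY, hfX⟩ : ∃ f : Fin m → V, f ∉ Y ∧ 2 * (tupCount Dg f + tupCount B f) ≤ m := by
    by_contra hcon
    push Not at hcon
    let Z : Finset (Fin m → V) :=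
      Finset.univ.filter (fun f => m < 2 * (tupCount Dg f + tupCount B f))
    have hcov : (Finset.univ : Finset (Fin m → V)) ⊆ Y ∪ Z := by
      intro f _
      by_cases hf : f ∈ Y
      · exact Finset.mem_union_left _ hf
      · exact Finset.mem_union_right _ (Finset.mem_filter.2 ⟨Finset.mem_univ _, hcon f hf⟩)
    have hc1 : N ^ m ≤ Y.card + Z.card := by
      have := (Finset.card_le_card hcov).trans (Finset.card_union_le _ _)
      simpa using this
    have hc2 : Z.card * m ≤ 2 * (∑ f : Fin m → V, (tupCount Dg f + tupCount B f)) := by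
      rw [Finset.mul_sum]
      calc Z.card * m = ∑ f ∈ Z, m := by simp
        _ ≤ ∑ f ∈ Z, 2 * (tupCount Dg f + tupCount B f) := by
            apply Finset.sum_le_sum; intro f hf; exact (Finset.mem_filter.1 hf).2.le
        _ ≤ _ := Finset.sum_le_sum_of_subset (Finset.subset_univ _)
    rw [Finset.sum_add_distrib] at hc2
    have hc3 : 4 * Z.card ≤ N ^ m := by
      refine Nat.le_of_mul_le_mul_right (c := m) ?_ (by omega)
      nlinarith
    have : 0 < N ^ m := by positivity
    omega
  -- deletion
  let Del : Finset (Fin m) :=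
    (Finset.univ.filter (fun ι : Fin 2 → Fin m => Function.Injective ι ∧ f ∘ ι ∈ Dg)).image
        (fun ι => ι 0) ∪
    (Finset.univ.filter (fun ι : Fin (r + 1) → Fin m => Function.Injective ι ∧ f ∘ ι ∈ B)).image
        (fun ι => ι 0)
  have hDel : Del.card ≤ tupCount Dg f + tupCount B f :=
    (Finset.card_union_le _ _).trans (Nat.add_le_add Finset.card_image_le Finset.card_image_le)
  let R := Finset.univ \ Del
  have hR : m ≤ 2 * R.card := by
    have : R.card = m - Del.card := by
      rw [Finset.card_sdiff_of_subset (Finset.subset_univ _)]; simp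
    omega
  have hinj : Set.InjOn f R := by
    intro i hi j hj hij
    by_contra hne
    apply (Finset.mem_sdiff.1 hi).2
    apply Finset.mem_union_left
    refine Finset.mem_image.2 ⟨![i, j], Finset.mem_filter.2 ⟨Finset.mem_univ _, ?_, ?_⟩, rfl⟩
    · intro a b hab
      fin_cases a <;> fin_cases b <;> simp_all
    · refine Finset.mem_image.2 ⟨f i, Finset.mem_univ _, ?_⟩
      funext a
      fin_cases a <;> simp [hij]
  refine ⟨R.image f, ?_, ?_, ?_⟩
  · rw [Finset.card_image_of_injOn hinj]; exact hR
  · intro b hb hbinj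
    by_contra hcon
    push Not at hcon
    have : ∀ t, ∃ i ∈ R, f i = b t := fun t => Finset.mem_image.1 (hcon t)
    choose ι hιR hι using this
    apply (Finset.mem_sdiff.1 (hιR 0)).2
    apply Finset.mem_union_right
    have hcomp : f ∘ ι = b := funext hι
    refine Finset.mem_image.2 ⟨ι, Finset.mem_filter.2 ⟨Finset.mem_univ _, ?_, ?_⟩, rfl⟩
    · apply Function.Injective.of_comp (f := f); rw [hcomp]; exact hbinj
    · rw [hcomp]; exact hb
  · intro T hT hTm C hC hTC
    apply hfY
    let J := R.filter (fun i => f i ∈ T)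
    have hJ : T ⊆ J.image f := by
      intro v hv
      obtain ⟨i, hi, rfl⟩ := Finset.mem_image.1 (hT hv)
      exact Finset.mem_image.2 ⟨i, Finset.mem_filter.2 ⟨hi, hv⟩, rfl⟩
    have hJc : T.card ≤ J.card := (Finset.card_le_card hJ).trans Finset.card_image_le
    refine Finset.mem_biUnion.2 ⟨J, Finset.mem_filter.2 ⟨Finset.mem_univ _,
      hTm.trans (Nat.mul_le_mul_left _ hJc)⟩, Finset.mem_biUnion.2 ⟨C, hC,
      Finset.mem_filter.2 ⟨Finset.mem_univ _, fun j hj => hTC (Finset.mem_filter.1 hj).2⟩⟩⟩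
end RandomSubset


section Grid

/-- `v` is the `i`-th point of the progression `x, x+d, x+2d, …`. -/
def OnAP {k n : ℕ} (x d : Fin k → ℤ) (i : ℕ) (v : Fin k → Fin n) : Prop :=
  ∀ t, ((v t : ℕ) : ℤ) = x t + (i : ℤ) * d t

open Classical in
/-- Hypergraph of `r`-subsets of progressions of length `K` in the grid. -/
noncomputable def apGraph (r k n K : ℕ) : Finset (Finset (Fin k → Fin n)) :=
  Finset.univ.filter (fun e => e.card = r ∧ ∃ x d : Fin k → ℤ, d ≠ 0 ∧ ∀ v ∈ e, ∃ i < K, OnAP x d i v)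

lemma OnAP.unique {k n : ℕ} {x d : Fin k → ℤ} {i : ℕ} {v w : Fin k → Fin n}
    (hv : OnAP x d i v) (hw : OnAP x d i w) : v = w := by
  funext t
  apply Fin.ext
  have := hv t
  have := hw t
  omega

lemma OnAP.determ {k n : ℕ} {x d x' d' : Fin k → ℤ} {i j : ℕ} {v w : Fin k → Fin n} (hij : i ≠ j)
    (hv : OnAP x d i v) (hw : OnAP x d j w) (hv' : OnAP x' d' i v) (hw' : OnAP x' d' j w) :
    x = x' ∧ d = d' := by
  have hd : d = d' := by
    funext t
    have h1 := hv t
    have h2 := hw t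
    have h3 := hv' t
    have h4 := hw' t
    have : ((i : ℤ) - j) * (d t - d' t) = 0 := by linear_combination h2 - h1 - h4 + h3
    rcases mul_eq_zero.1 this with h | h
    · exact absurd (by omega) hij
    · omega
  subst hd
  refine ⟨?_, rfl⟩
  funext t
  have h1 := hv t
  have h3 := hv' t
  linarith

open Classical in
lemma apGraph_codeg (r k n K : ℕ) (u w : Fin k → Fin n) (huw : u ≠ w) :
    ((apGraph r k n K).filter (fun g => u ∈ g ∧ w ∈ g)).card ≤ K * K * 2 ^ K := by
  let Q : ℕ × ℕ → Finset (Fin k → Fin n) := fun p =>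
    (Finset.range K).biUnion (fun l => Finset.univ.filter (fun v =>
      ∃ x d : Fin k → ℤ, p.1 ≠ p.2 ∧ OnAP x d p.1 u ∧ OnAP x d p.2 w ∧ OnAP x d l v))
  have hQ : ∀ p, (Q p).card ≤ K := by
    intro p
    refine (Finset.card_biUnion_le_card_mul _ _ 1 ?_).trans (by simp)
    intro l _
    rw [Finset.card_le_one]
    intro v hv v' hv'
    obtain ⟨x, d, h0, h1, h2, h3⟩ := (Finset.mem_filter.1 hv).2
    obtain ⟨x', d', _, h1', h2', h3'⟩ := (Finset.mem_filter.1 hv').2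
    obtain ⟨rfl, rfl⟩ := OnAP.determ h0 h1 h2 h1' h2'
    exact h3.unique h3'
  have hsub : (apGraph r k n K).filter (fun g => u ∈ g ∧ w ∈ g) ⊆
      (Finset.range K ×ˢ Finset.range K).biUnion (fun p => (Q p).powerset) := by
    intro g hg
    obtain ⟨h1, hu, hw⟩ := Finset.mem_filter.1 hg
    obtain ⟨_, x, d, hd, hall⟩ := (Finset.mem_filter.1 h1).2
    obtain ⟨i, hi, hui⟩ := hall u hu
    obtain ⟨j, hj, hwj⟩ := hall w hw
    have hij : i ≠ j := by
      rintro rfl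
      exact huw (hui.unique hwj)
    refine Finset.mem_biUnion.2 ⟨(i, j), by simp [hi, hj], Finset.mem_powerset.2 ?_⟩
    intro v hv
    obtain ⟨l, hl, hvl⟩ := hall v hv
    exact Finset.mem_biUnion.2 ⟨l, by simpa using hl, Finset.mem_filter.2
      ⟨Finset.mem_univ _, x, d, hij, hui, hwj, hvl⟩⟩
  refine (Finset.card_le_card hsub).trans ((Finset.card_biUnion_le_card_mul _ _ (2 ^ K) ?_).trans
    (by simp))
  intro p _
  rw [Finset.card_powerset]
  exact Nat.pow_le_pow_right (by norm_num) (hQ p)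

set_option maxHeartbeats 1000000 in
open Classical in
lemma apGraph_supersat (r k K M E n : ℕ) (hn : n = K * M) (hr : 2 ≤ r) (hk : 1 ≤ k) (hE : 1 ≤ E)
    (hK : K = 2 * 2 ^ k * r * E) (W : Finset (Fin k → Fin n))
    (hW : n ^ k < E * W.card) :
    n ^ k * n ^ k ≤ 2 * E * K ^ k * (K * K) *
      ((apGraph r k n K).filter (fun e => e ⊆ W)).card := by
  have hKpos : 0 < K := by rw [hK]; positivity
  have hWne : W.Nonempty := by
    rw [← Finset.card_pos]
    by_contra h
    have : W.card = 0 := by omega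
    simp [this] at hW
  haveI : Nonempty (Fin k → Fin n) := ⟨hWne.choose⟩
  let X : Finset (Fin k → ℤ) := Fintype.piFinset (fun _ => Finset.Ico (-(n : ℤ)) n)
  let Ds : Finset (Fin k → ℤ) := Fintype.piFinset (fun _ => Finset.Icc (1 : ℤ) M)
  have hX : X.card = 2 ^ k * n ^ k := by
    simp only [X, Fintype.card_piFinset, Int.card_Ico, Finset.prod_const, Finset.card_univ,
      Fintype.card_fin, ← mul_pow]
    congr 1
    omega
  have hDs : Ds.card = M ^ k := by
    simp [Ds, Fintype.card_piFinset]
  let ix : (Fin k → ℤ) → (Fin k → ℤ) → Finset ℕ := fun x d =>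
    (Finset.range K).filter (fun i => ∃ w ∈ W, OnAP x d i w)
  -- each direction has many rich starting points
  have hdir : ∀ d ∈ Ds, W.card ≤ 2 * (X.filter (fun x => r ≤ (ix x d).card)).card := by
    intro d hd
    have hd' : ∀ t, 1 ≤ d t ∧ d t ≤ M := by
      intro t
      have := Fintype.mem_piFinset.1 hd t
      simpa using this
    have hcount : K * W.card ≤ ∑ x ∈ X, (ix x d).card := by
      rw [← Finset.card_sigma]
      have : K * W.card = (Finset.range K ×ˢ W).card := by simp
      rw [this]
      apply Finset.card_le_card_of_injOn
        (fun p => (⟨fun t => ((p.2 t : ℕ) : ℤ) - (p.1 : ℤ) * d t, p.1⟩ : Σ _ : Fin k → ℤ, ℕ))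
      · rintro ⟨i, w⟩ hp
        have hp := Finset.mem_product.1 hp
        simp only at hp
        have hi : i < K := by simpa using hp.1
        refine Finset.mem_coe.2 (Finset.mem_sigma.2 ⟨?_, ?_⟩)
        · rw [Fintype.mem_piFinset]
          intro t
          rw [Finset.mem_Ico]
          have h1 := hd' t
          have h2 := (w t).isLt
          have h3 : (i : ℤ) * d t ≤ n := by
            have : (n : ℤ) = K * M := by rw [hn]; push_cast; rfl
            rw [this]
            exact mul_le_mul (by omega) h1.2 (by omega) (by omega)
          have h4 : 0 ≤ (i : ℤ) * d t := mul_nonneg (by omega) (by omega)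
          show -(n : ℤ) ≤ ((w t : ℕ) : ℤ) - (i : ℤ) * d t ∧ ((w t : ℕ) : ℤ) - (i : ℤ) * d t < n
          constructor <;> omega
        · refine Finset.mem_filter.2 ⟨hp.1, w, hp.2, ?_⟩
          intro t
          simp
      · rintro ⟨i, w⟩ _ ⟨i', w'⟩ _ he
        simp only [Sigma.mk.injEq, heq_eq_eq] at he
        obtain ⟨h1, rfl⟩ := he
        have : w = w' := by
          funext t
          apply Fin.ext
          have : ((w t : ℕ) : ℤ) - (i : ℤ) * d t = ((w' t : ℕ) : ℤ) - (i : ℤ) * d t := congrFun h1 t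
          omega
        rw [this]
    have hsum : ∑ x ∈ X, (ix x d).card ≤
        (X.filter (fun x => r ≤ (ix x d).card)).card * K + X.card * r := by
      rw [← Finset.sum_filter_add_sum_filter_not X (fun x => r ≤ (ix x d).card)]
      apply Nat.add_le_add
      · apply Finset.sum_le_card_nsmul
        intro x _
        exact (Finset.card_filter_le _ _).trans (by simp)
      · refine (Finset.sum_le_card_nsmul _ _ r ?_).trans ?_
        · intro x hx
          have := (Finset.mem_filter.1 hx).2
          omega
        · exact Nat.mul_le_mul_right _ (Finset.card_filter_le _ _)
    have hXr : 2 * (X.card * r) ≤ K * W.card := by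
      rw [hX, hK]
      calc 2 * (2 ^ k * n ^ k * r) = 2 * 2 ^ k * r * n ^ k := by ring
        _ ≤ 2 * 2 ^ k * r * (E * W.card) := Nat.mul_le_mul_left _ hW.le
        _ = _ := by ring
    refine Nat.le_of_mul_le_mul_left (c := K) ?_ hKpos
    nlinarith
  -- all rich pairs
  let good : Finset (Σ _ : Fin k → ℤ, Fin k → ℤ) :=
    Ds.sigma (fun d => X.filter (fun x => r ≤ (ix x d).card))
  have hgood : M ^ k * W.card ≤ 2 * good.card := by
    rw [Finset.card_sigma, Finset.mul_sum, ← hDs]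
    exact Finset.card_nsmul_le_sum _ _ _ hdir
  -- an edge for each rich pair
  have hedge : ∀ p ∈ good, ∃ e : Finset (Fin k → Fin n), e ⊆ W ∧ e.card = r ∧
      ∀ v ∈ e, ∃ i < K, OnAP p.2 p.1 i v := by
    rintro ⟨d, x⟩ hp
    obtain ⟨hd, hx⟩ := Finset.mem_sigma.1 hp
    have hrx := (Finset.mem_filter.1 hx).2
    simp only at hd hrx ⊢
    have hw : ∀ i ∈ ix x d, ∃ w ∈ W, OnAP x d i w := fun i hi => (Finset.mem_filter.1 hi).2
    choose! φ hφW hφ using hw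
    have hinj : Set.InjOn φ (ix x d : Set ℕ) := by
      intro i hi j hj hij
      have h1 := hφ i hi ⟨0, hk⟩
      have h2 := hφ j hj ⟨0, hk⟩
      rw [hij] at h1
      have h3 : 1 ≤ d ⟨0, hk⟩ := (Finset.mem_Icc.1 (Fintype.mem_piFinset.1 hd ⟨0, hk⟩)).1
      have h4 : ((i : ℤ) - j) * d ⟨0, hk⟩ = 0 := by linear_combination h2 - h1
      rcases mul_eq_zero.1 h4 with h | h
      · omega
      · omega
    obtain ⟨I, hI, hIc⟩ := Finset.exists_subset_card_eq hrx
    refine ⟨I.image φ, ?_, ?_, ?_⟩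
    · intro v hv
      obtain ⟨i, hi, rfl⟩ := Finset.mem_image.1 hv
      exact hφW i (hI hi)
    · rw [Finset.card_image_of_injOn (hinj.mono (by exact_mod_cast hI)), hIc]
    · intro v hv
      obtain ⟨i, hi, rfl⟩ := Finset.mem_image.1 hv
      exact ⟨i, by simpa using (Finset.mem_filter.1 (hI hi)).1, hφ i (hI hi)⟩
  choose! ed hedW hedc hed using hedge
  have hfib : good.card ≤ (K * K) * ((apGraph r k n K).filter (fun e => e ⊆ W)).card := by
    apply Finset.card_le_mul_card_image_of_maps_to (f := ed)
    · intro p hp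
      refine Finset.mem_filter.2 ⟨Finset.mem_filter.2 ⟨Finset.mem_univ _, hedc p hp, p.2, p.1, ?_,
        hed p hp⟩, hedW p hp⟩
      intro h0
      have hd := (Finset.mem_sigma.1 hp).1
      have h3 : 1 ≤ p.1 ⟨0, hk⟩ := (Finset.mem_Icc.1 (Fintype.mem_piFinset.1 hd ⟨0, hk⟩)).1
      rw [h0] at h3
      simp at h3
    · intro e he
      have hec : e.card = r := (Finset.mem_filter.1 (Finset.mem_filter.1 he).1).2.1
      obtain ⟨u, hu, w, hw, huw⟩ := Finset.one_lt_card.1 (by omega : 1 < e.card)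
      have hij : ∀ p ∈ good.filter (fun p => ed p = e), ∃ ij : ℕ × ℕ, ij.1 < K ∧ ij.2 < K ∧
          OnAP p.2 p.1 ij.1 u ∧ OnAP p.2 p.1 ij.2 w := by
        intro p hp
        obtain ⟨hpg, rfl⟩ := Finset.mem_filter.1 hp
        obtain ⟨i, hi, h1⟩ := hed p hpg u hu
        obtain ⟨j, hj, h2⟩ := hed p hpg w hw
        exact ⟨(i, j), hi, hj, h1, h2⟩
      choose! ψ h1 h2 h3 h4 using hij
      have hc : (Finset.range K ×ˢ Finset.range K).card = K * K := by simp
      rw [← hc]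
      apply Finset.card_le_card_of_injOn ψ
      · intro p hp
        have a1 := h1 p hp
        have a2 := h2 p hp
        simp [a1, a2]
      · intro p hp p' hp' heq
        have b1 := h3 p hp
        have b2 := h4 p hp
        have b3 := h3 p' hp'
        have b4 := h4 p' hp'
        rw [← heq] at b3 b4
        have hne : (ψ p).1 ≠ (ψ p).2 := by
          intro h
          rw [← h] at b2
          exact huw (b1.unique b2)
        obtain ⟨c1, c2⟩ := OnAP.determ hne b1 b2 b3 b4
        obtain ⟨d, x⟩ := p
        obtain ⟨d', x'⟩ := p'
        simp only at c1 c2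
        subst c1; subst c2; rfl
  calc n ^ k * n ^ k ≤ (E * W.card) * n ^ k := Nat.mul_le_mul_right _ hW.le
    _ = E * K ^ k * (M ^ k * W.card) := by
        have : n ^ k = K ^ k * M ^ k := by rw [hn, mul_pow]
        rw [this]; ring
    _ ≤ E * K ^ k * (2 * ((K * K) * ((apGraph r k n K).filter (fun e => e ⊆ W)).card)) := by
        apply Nat.mul_le_mul_left
        exact hgood.trans (Nat.mul_le_mul_left _ hfib)
    _ = _ := by ring
end Grid

section Projection

lemma exists_transc : ∃ θ : ℝ, Transcendental ℤ θ :=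
  ⟨_, Liouville.transcendental (liouville_liouvilleNumber (m := 2) le_rfl)⟩

lemma transc_indep {ι : Type} [Fintype ι] {θ : ℝ} (hθ : Transcendental ℤ θ) (e : ι → ℕ)
    (he : Function.Injective e) (c : ι → ℤ) (h : ∑ i, (c i : ℝ) * θ ^ e i = 0) : ∀ i, c i = 0 := by
  classical
  intro i
  let p : Polynomial ℤ := ∑ i, Polynomial.C (c i) * Polynomial.X ^ e i
  have hp : Polynomial.aeval θ p = 0 := by
    simp only [p, map_sum, map_mul, map_pow, Polynomial.aeval_X, Polynomial.aeval_C]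
    simpa using h
  have hp0 : p = 0 := by
    by_contra hne
    exact hθ ⟨p, hne, hp⟩
  have : p.coeff (e i) = c i := by
    simp only [p, Polynomial.finsetSum_coeff, Polynomial.coeff_C_mul, Polynomial.coeff_X_pow]
    rw [Finset.sum_eq_single i]
    · simp
    · intro j _ hj
      rw [if_neg (fun h => hj (he h).symm), mul_zero]
    · simp
  rw [← this, hp0]; simp

/-- generic linear map to the plane -/
noncomputable def prj {k : ℕ} (θ : ℝ) (x : Fin k → ℤ) : Fin 2 → ℝ :=
  ![∑ j, (x j : ℝ) * θ ^ (j : ℕ), ∑ j, (x j : ℝ) * θ ^ (k * (j : ℕ))]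

lemma prj_ne_zero {k : ℕ} {θ : ℝ} (hθ : Transcendental ℤ θ) (x : Fin k → ℤ) (hx : x ≠ 0) :
    prj θ x ≠ 0 := by
  intro h
  apply hx
  have h0 := congrFun h 0
  simp only [prj, Matrix.cons_val_zero, Pi.zero_apply] at h0
  funext i
  exact transc_indep hθ (fun j : Fin k => (j : ℕ)) Fin.val_injective x h0 i

lemma prj_add_mul {k : ℕ} (θ : ℝ) (x d : Fin k → ℤ) (a : ℤ) :
    prj θ (fun t => x t + a * d t) = prj θ x + (a : ℝ) • prj θ d := by
  funext i
  fin_cases i <;>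
  · simp [prj, Finset.mul_sum, ← Finset.sum_add_distrib]
    apply Finset.sum_congr rfl
    intro j _
    ring

lemma prj_parallel {k : ℕ} {θ : ℝ} (hθ : Transcendental ℤ θ) (x y : Fin k → ℤ)
    (h : prj θ x 0 * prj θ y 1 = prj θ x 1 * prj θ y 0) (a b : Fin k) :
    x a * y b = x b * y a := by
  have := transc_indep hθ (fun p : Fin k × Fin k => (p.1 : ℕ) + k * (p.2 : ℕ)) (by
    rintro ⟨a, b⟩ ⟨c, d⟩ h
    simp only at h
    have hk : 0 < k := a.pos
    have h1 := congrArg (· % k) h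
    have h2 := congrArg (· / k) h
    simp only [Nat.add_mul_mod_self_left, Nat.mod_eq_of_lt a.isLt, Nat.mod_eq_of_lt c.isLt] at h1
    simp only [Nat.add_mul_div_left _ _ hk, Nat.div_eq_of_lt a.isLt, Nat.div_eq_of_lt c.isLt,
      zero_add] at h2
    rw [Prod.mk.injEq]
    exact ⟨Fin.ext h1, Fin.ext h2⟩) (fun p => x p.1 * y p.2 - x p.2 * y p.1) (by
    rw [Fintype.sum_prod_type]
    simp only [prj, Matrix.cons_val_zero, Matrix.cons_val_one] at h
    rw [Finset.sum_mul_sum, Finset.sum_mul_sum] at h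
    rw [Finset.sum_comm (s := Finset.univ) (t := Finset.univ)
      (f := fun i j : Fin k => (x i : ℝ) * θ ^ (k * (i : ℕ)) * ((y j : ℝ) * θ ^ (j : ℕ)))] at h
    rw [← sub_eq_zero, ← Finset.sum_sub_distrib] at h
    rw [← h]
    apply Finset.sum_congr rfl
    intro i _
    rw [← Finset.sum_sub_distrib]
    apply Finset.sum_congr rfl
    intro j _
    push_cast
    rw [pow_add]
    ring) (a, b)
  simp only at this
  omega

/-- embedding of the grid in the plane -/
noncomputable def gridPt {k n : ℕ} (θ : ℝ) (v : Fin k → Fin n) : Fin 2 → ℝ :=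
  prj θ (fun t => ((v t : ℕ) : ℤ))

lemma gridPt_sub {k n : ℕ} (θ : ℝ) (u v : Fin k → Fin n) :
    gridPt θ u - gridPt θ v = prj θ (fun t => ((u t : ℕ) : ℤ) - ((v t : ℕ) : ℤ)) := by
  have := prj_add_mul θ (fun t => ((u t : ℕ) : ℤ)) (fun t => ((v t : ℕ) : ℤ)) (-1)
  rw [show (fun t => ((u t : ℕ) : ℤ) - ((v t : ℕ) : ℤ)) =
    (fun t => ((u t : ℕ) : ℤ) + -1 * ((v t : ℕ) : ℤ)) by funext t; ring, this]
  simp [gridPt, sub_eq_add_neg]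

lemma gridPt_injective {k n : ℕ} {θ : ℝ} (hθ : Transcendental ℤ θ) :
    Function.Injective (gridPt (k := k) (n := n) θ) := by
  intro u v h
  by_contra hne
  have h1 := gridPt_sub θ u v
  rw [h, sub_self] at h1
  apply prj_ne_zero hθ _ _ h1.symm
  intro h0
  apply hne
  funext t
  apply Fin.ext
  have := congrFun h0 t
  simp only [Pi.zero_apply] at this
  omega

lemma gridPt_line {k n : ℕ} {θ : ℝ} (hθ : Transcendental ℤ θ) (x d : Fin k → ℤ) (hd : d ≠ 0) :
    ∃ L, IsLine L ∧ ∀ (v : Fin k → Fin n) (i : ℕ), OnAP x d i v → gridPt θ v ∈ L := by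
  refine ⟨_, ⟨prj θ x, prj θ d, prj_ne_zero hθ d hd, rfl⟩, ?_⟩
  intro v i hv
  refine ⟨i, ?_⟩
  have := prj_add_mul θ x d i
  simp only [Int.cast_natCast] at this
  rw [← this]
  unfold gridPt
  congr 1
  funext t
  exact hv t

/-- collinearity in the grid -/
def GCol {k n : ℕ} (u v w : Fin k → Fin n) : Prop :=
  ∀ a b : Fin k, (((v a : ℕ) : ℤ) - ((u a : ℕ) : ℤ)) * (((w b : ℕ) : ℤ) - ((u b : ℕ) : ℤ)) =
    (((v b : ℕ) : ℤ) - ((u b : ℕ) : ℤ)) * (((w a : ℕ) : ℤ) - ((u a : ℕ) : ℤ))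

lemma gcol_of_line {k n : ℕ} {θ : ℝ} (hθ : Transcendental ℤ θ) (L : Set (Fin 2 → ℝ)) (hL : IsLine L)
    (u v w : Fin k → Fin n) (hu : gridPt θ u ∈ L) (hv : gridPt θ v ∈ L) (hw : gridPt θ w ∈ L) :
    GCol u v w := by
  obtain ⟨p, q, hq, rfl⟩ := hL
  obtain ⟨s1, h1⟩ := hu
  obtain ⟨s2, h2⟩ := hv
  obtain ⟨s3, h3⟩ := hw
  intro a b
  apply prj_parallel hθ (fun t => ((v t : ℕ) : ℤ) - ((u t : ℕ) : ℤ))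
    (fun t => ((w t : ℕ) : ℤ) - ((u t : ℕ) : ℤ))
  rw [← gridPt_sub, ← gridPt_sub, h1, h2, h3]
  simp
  ring

open Classical in
noncomputable def badTuples (k n r : ℕ) : Finset (Fin (r + 2) → (Fin k → Fin n)) :=
  Finset.univ.filter (fun b => b 0 ≠ b 1 ∧ ∀ t, GCol (b 0) (b 1) (b t))

lemma badTuples_card (k n r : ℕ) : (badTuples k n r).card ≤ n ^ k * n ^ k * n ^ r := by
  classical
  rcases Nat.eq_zero_or_pos k with hk | hk
  · subst hk
    have : badTuples 0 n r = ∅ := by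
      rw [Finset.eq_empty_iff_forall_notMem]
      intro b hb
      exact (Finset.mem_filter.1 hb).2.1 (Subsingleton.elim _ _)
    simp [this]
  have : n ^ k * n ^ k * n ^ r = (Finset.univ : Finset (((Fin k → Fin n) × (Fin k → Fin n)) ×
      (Fin r → Fin n))).card := by simp
  rw [this]
  haveI : Nonempty (Fin k) := ⟨⟨0, hk⟩⟩
  have hc : ∀ u v : Fin k → Fin n, u ≠ v → ∃ a, u a ≠ v a := fun u v h => Function.ne_iff.1 h
  choose! co hco using hc
  apply Finset.card_le_card_of_injOn
    (fun b => ((b 0, b 1), fun t : Fin r => b t.succ.succ (co (b 0) (b 1))))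
  · intro b _; simp
  · intro b hb b' hb' he
    obtain ⟨h1, h2⟩ := (Finset.mem_filter.1 hb).2
    obtain ⟨h1', h2'⟩ := (Finset.mem_filter.1 hb').2
    simp only [Prod.mk.injEq] at he
    obtain ⟨⟨e0, e1⟩, e2⟩ := he
    rw [← e0, ← e1] at h1' h2'
    rw [← e0, ← e1] at e2
    set a := co (b 0) (b 1) with ha
    have hane := hco _ _ h1
    have hane' : ((b 1 a : ℕ) : ℤ) - ((b 0 a : ℕ) : ℤ) ≠ 0 := by
      intro h
      apply hane
      apply Fin.ext
      rw [← ha]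
      omega
    funext t
    refine Fin.cases e0 (fun t => Fin.cases e1 (fun t => ?_) t) t
    have ea : b t.succ.succ a = b' t.succ.succ a := congrFun e2 t
    funext c
    have g1 := h2 t.succ.succ a c
    have g2 := h2' t.succ.succ a c
    rw [← ea] at g2
    have := mul_left_cancel₀ hane' (g1.trans g2.symm)
    apply Fin.ext
    omega

end Projection

section Final

lemma pow_le_two_pow (p : ℕ) : ∃ n0 : ℕ, ∀ n, n0 ≤ n → n ^ p ≤ 2 ^ n := by
  have h := (isLittleO_pow_const_const_pow_of_one_lt (R := ℝ) p (r := 2) (by norm_num)).bound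
    (c := 1) one_pos
  obtain ⟨n0, hn0⟩ := Filter.eventually_atTop.1 h
  refine ⟨n0, fun n hn => ?_⟩
  have := hn0 n hn
  rw [one_mul, Real.norm_of_nonneg (by positivity), Real.norm_of_nonneg (by positivity)] at this
  exact_mod_cast this

lemma poly_exp (k L : ℕ) : ∃ n0 : ℕ, ∀ n, n0 ≤ n → (n ^ k + 1) ^ L ≤ 2 ^ n := by
  obtain ⟨n0, h⟩ := pow_le_two_pow ((k + 1) * L)
  refine ⟨max n0 2, fun n hn => ?_⟩
  have h1 : n0 ≤ n := (le_max_left _ _).trans hn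
  have h2 : 2 ≤ n := (le_max_right _ _).trans hn
  refine le_trans ?_ (h n h1)
  rw [pow_mul]
  apply Nat.pow_le_pow_left
  have h3 : 1 ≤ n ^ k := Nat.one_le_pow _ _ (by omega)
  rw [pow_succ]
  nlinarith

lemma grid_main (s q0 : ℕ) : ∃ (k n m K : ℕ) (S : Finset (Fin k → Fin n)),
    1 ≤ m ∧ m ≤ 2 * S.card ∧
    (∀ b ∈ badTuples k n (s + 1), Function.Injective b → ∃ t, b t ∉ S) ∧
    ∀ T ⊆ S, m ≤ q0 * T.card → ∃ e ∈ apGraph (s + 2) k n K, e ⊆ T := by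
  classical
  obtain ⟨E, hE⟩ : ∃ E, E = 8 ^ q0 := ⟨_, rfl⟩
  have hE1 : 1 ≤ E := by rw [hE]; exact Nat.one_le_pow _ _ (by norm_num)
  obtain ⟨k, hk⟩ : ∃ k, k = 2 * (s + 2) * (s + 1) := ⟨_, rfl⟩
  have hk1 : 1 ≤ k := by rw [hk]; exact Nat.mul_pos (by omega) (by omega)
  obtain ⟨K, hK⟩ : ∃ K, K = 2 * 2 ^ k * (s + 2) * E := ⟨_, rfl⟩
  have hK1 : 1 ≤ K := by rw [hK]; exact Nat.mul_pos (by positivity) (by omega)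
  obtain ⟨L, hL⟩ := container_theorem (s + 2) (K * K * 2 ^ K) E (2 * E * K ^ k * (K * K))
    (by omega) (Nat.mul_pos (Nat.mul_pos (by omega) (by positivity)) (by positivity))
  obtain ⟨n0, hn0⟩ := poly_exp k L
  obtain ⟨M, hM⟩ : ∃ M, M = n0 + 16 := ⟨_, rfl⟩
  obtain ⟨n, hn⟩ : ∃ n, n = K * M := ⟨_, rfl⟩
  have hMn : M ≤ n := by rw [hn]; exact Nat.le_mul_of_pos_left _ hK1
  have hn16 : 16 ≤ n := by omega
  have hexp := hn0 n (by omega)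
  obtain ⟨lam, hlam⟩ : ∃ lam, lam = n ^ (2 * (s + 2)) := ⟨_, rfl⟩
  have hlam1 : 1 ≤ lam := by rw [hlam]; exact Nat.one_le_pow _ _ (by omega)
  have hcard : Fintype.card (Fin k → Fin n) = n ^ k := by simp
  have hN : n ^ k = lam ^ (s + 1) := by rw [hlam, ← pow_mul, hk]
  have hlamn : 16 * n ^ (2 * s + 3) ≤ lam := by
    rw [hlam, show 2 * (s + 2) = (2 * s + 3) + 1 by ring, pow_succ n (2 * s + 3), mul_comm]
    exact Nat.mul_le_mul_left _ hn16
  obtain ⟨𝒞, hC1, hC2, hC3⟩ := hL (V := Fin k → Fin n) lam hlam1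
    (by rw [hcard, hN]; rfl) (apGraph (s + 2) k n K)
    (fun e he => (Finset.mem_filter.1 he).2.1)
    (fun u w huw => by
      have := apGraph_codeg (s + 2) k n K u w huw
      convert this)
    (fun W hW => by
      rw [hcard] at hW ⊢
      have := apGraph_supersat (s + 2) k K M E n hn (by omega) hk1 hE1 hK W hW
      convert this)
  have hm1 : 1 ≤ n * lam ^ s := Nat.mul_pos (by omega) (Nat.pow_pos hlam1)
  obtain ⟨S, hS1, hS2, hS3⟩ := random_subset (n * lam ^ s) (s + 2) q0 E 𝒞 (badTuples k n (s + 1))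
    (by
      refine hC1.trans ?_
      rw [hcard, pow_mul, pow_mul]
      exact Nat.pow_le_pow_left hexp _)
    hC2 hE.ge hm1
    (by
      rw [hcard, hN, pow_succ]
      have : n ≤ n ^ (2 * s + 3) := Nat.le_self_pow (by omega) n
      calc 16 * (n * lam ^ s) = lam ^ s * (16 * n) := by ring
        _ ≤ lam ^ s * lam := Nat.mul_le_mul_left _ (by omega))
    (by
      have hb := badTuples_card k n (s + 1)
      rw [hcard]
      calc 16 * ((n * lam ^ s) ^ (s + 2) * (badTuples k n (s + 1)).card)
          ≤ 16 * ((n * lam ^ s) ^ (s + 2) * (n ^ k * n ^ k * n ^ (s + 1))) := by gcongr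
        _ = (16 * n ^ (2 * s + 3)) * ((lam ^ s) ^ (s + 2) * (n ^ k * n ^ k)) := by
            rw [mul_pow]; ring
        _ ≤ lam * ((lam ^ s) ^ (s + 2) * (n ^ k * n ^ k)) := Nat.mul_le_mul_right _ hlamn
        _ = (n ^ k) ^ (s + 2 + 1) := by
            rw [hN, ← pow_mul, ← pow_mul, ← pow_add, ← pow_add, ← pow_succ']
            congr 1
            ring)
  refine ⟨k, n, n * lam ^ s, K, S, hm1, hS1, hS2, ?_⟩
  intro T hT hTm
  by_contra hno
  push Not at hno
  obtain ⟨C, hC, hTC⟩ := hC3 T hno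
  exact hS3 T hT hTm C hC hTC

end Final

/-- The construction of Section 6 of the paper: for every c > 0 and every sufficiently
large r there is a finite planar point set S with no r+1 points on a line such that every
subset of S of size at least c·|S| contains r points on a common line. -/
theorem dense_subsets_contain_r_collinear :
    ∀ c : ℝ, 0 < c → ∃ r₀ : ℕ, ∀ r : ℕ, r₀ ≤ r →
      ∃ S : Finset (Fin 2 → ℝ),
        (∀ L : Set (Fin 2 → ℝ), IsLine L → (L ∩ (S : Set (Fin 2 → ℝ))).ncard ≤ r) ∧
        ∀ T ⊆ S, c * (S.card : ℝ) ≤ (T.card : ℝ) →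
          ∃ L : Set (Fin 2 → ℝ), IsLine L ∧ r ≤ (L ∩ (T : Set (Fin 2 → ℝ))).ncard := by
  classical
  intro c hc
  refine ⟨2, fun r hr => ?_⟩
  obtain ⟨s, rfl⟩ : ∃ s, r = s + 2 := ⟨r - 2, by omega⟩
  obtain ⟨q0, hq0⟩ := exists_nat_ge (2 / c)
  obtain ⟨θ, hθ⟩ := exists_transc
  obtain ⟨k, n, m, K, S, hm1, hS1, hS2, hS3⟩ := grid_main s q0
  have hinj := gridPt_injective (k := k) (n := n) hθ
  refine ⟨S.image (gridPt θ), ?_, ?_⟩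
  · intro L hL
    by_contra hlt
    push Not at hlt
    obtain ⟨P, hP⟩ : ∃ P, P = S.filter (fun v => gridPt θ v ∈ L) := ⟨_, rfl⟩
    have hset : L ∩ ((S.image (gridPt θ) : Finset (Fin 2 → ℝ)) : Set (Fin 2 → ℝ)) =
        ((P.image (gridPt θ) : Finset (Fin 2 → ℝ)) : Set (Fin 2 → ℝ)) := by
      ext x
      simp only [hP, Set.mem_inter_iff, Finset.coe_image, Set.mem_image, Finset.mem_coe,
        Finset.mem_filter]
      constructor
      · rintro ⟨h1, v, hv, rfl⟩
        exact ⟨v, ⟨hv, h1⟩, rfl⟩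
      · rintro ⟨v, ⟨hv, h1⟩, rfl⟩
        exact ⟨h1, v, hv, rfl⟩
    rw [hset, Set.ncard_coe_finset, Finset.card_image_of_injective _ hinj] at hlt
    obtain ⟨Q, hQP, hQc⟩ := Finset.exists_subset_card_eq (show s + 1 + 2 ≤ P.card by omega)
    let ee := Q.equivFinOfCardEq hQc
    let b : Fin (s + 1 + 2) → (Fin k → Fin n) := fun t => (ee.symm t : Fin k → Fin n)
    have hbinj : Function.Injective b := Subtype.val_injective.comp ee.symm.injective
    have hbP : ∀ t, b t ∈ S ∧ gridPt θ (b t) ∈ L := by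
      intro t
      have : b t ∈ P := hQP (ee.symm t).2
      rw [hP] at this
      exact Finset.mem_filter.1 this
    obtain ⟨t, ht⟩ := hS2 b (Finset.mem_filter.2 ⟨Finset.mem_univ _, fun h => by
      have := hbinj h
      simp at this, fun t => gcol_of_line hθ L hL _ _ _ (hbP 0).2 (hbP 1).2 (hbP t).2⟩) hbinj
    exact ht (hbP t).1
  · intro T hT hTc
    rw [Finset.card_image_of_injective _ hinj] at hTc
    obtain ⟨P, hP⟩ : ∃ P, P = S.filter (fun v => gridPt θ v ∈ T) := ⟨_, rfl⟩
    have hPT : P.image (gridPt θ) = T := by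
      ext x
      simp only [hP, Finset.mem_image, Finset.mem_filter]
      constructor
      · rintro ⟨v, ⟨_, h1⟩, rfl⟩
        exact h1
      · intro hx
        obtain ⟨v, hv, rfl⟩ := Finset.mem_image.1 (hT hx)
        exact ⟨v, ⟨hv, hx⟩, rfl⟩
    have hPc : P.card = T.card := by rw [← hPT, Finset.card_image_of_injective _ hinj]
    have hmP : m ≤ q0 * P.card := by
      rw [hPc]
      have h1 : (m : ℝ) ≤ 2 * S.card := by exact_mod_cast hS1
      have h2 : (2 : ℝ) ≤ q0 * c := by
        rwa [div_le_iff₀ hc] at hq0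
      have h3 : (m : ℝ) ≤ q0 * T.card := by
        calc (m : ℝ) ≤ 2 * S.card := h1
          _ ≤ (q0 * c) * S.card := mul_le_mul_of_nonneg_right h2 (by positivity)
          _ = q0 * (c * S.card) := by ring
          _ ≤ q0 * T.card := mul_le_mul_of_nonneg_left hTc (by positivity)
      exact_mod_cast h3
    obtain ⟨e, he, heP⟩ := hS3 P (by rw [hP]; exact Finset.filter_subset _ _) hmP
    obtain ⟨hec, x, d, hd, hed⟩ := (Finset.mem_filter.1 he).2
    obtain ⟨L, hL, hLv⟩ := gridPt_line (n := n) hθ x d hd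
    refine ⟨L, hL, ?_⟩
    have h1 : ((e.image (gridPt θ) : Finset (Fin 2 → ℝ)) : Set (Fin 2 → ℝ)) ⊆
        L ∩ (T : Set (Fin 2 → ℝ)) := by
      intro y hy
      obtain ⟨v, hv, rfl⟩ := Finset.mem_image.1 (Finset.mem_coe.1 hy)
      obtain ⟨i, _, hi⟩ := hed v hv
      refine ⟨hLv v i hi, ?_⟩
      have := heP hv
      rw [hP] at this
      exact Finset.mem_coe.2 (Finset.mem_filter.1 this).2
    have h2 := Set.ncard_le_ncard h1 (T.finite_toSet.subset Set.inter_subset_right)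
    rwa [Set.ncard_coe_finset, Finset.card_image_of_injective _ hinj, hec] at h2
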